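/- Let X and Y be Banach spaces and T : X → Y an absolutely 2-summing operator. Then Γ_n(T) ≤ e·n^{−1/2}·‖T|B₂‖·Γ_n(X) for all n ≥ 1. -/

import Mathlib

open scoped BigOperators NNReal ENNReal

noncomputable section

/-- The span of the first `n` elements of the sequence `f`. -/
def greedySpan {X : Type*} [NormedAddCommGroup X] [NormedSpace ℝ X]
    (f : ℕ → X) (n : ℕ) : Submodule ℝ X :=
  Submodule.span ℝ (f '' Set.Iio n)

/-- The `n`-th greedy error `σ_n = dist(f_n, V_n)`. For `n = 0` this is `‖f 0‖`. -/
def greedyErr {X : Type*} [NormedAddCommGroup X] [NormedSpace ℝ X]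
    (f : ℕ → X) (n : ℕ) : ℝ :=
  Metric.infDist (f n) (greedySpan f n : Set X)

/-- `f` is a greedy sequence for `K`: each `f n` lies in `K` and maximizes the distance to
`V_n = span{f_0,…,f_{n-1}}` among elements of `K` (for `n = 0`, `‖f 0‖ = max_{g∈K} ‖g‖`). -/
def IsGreedySeq {X : Type*} [NormedAddCommGroup X] [NormedSpace ℝ X]
    (K : Set X) (f : ℕ → X) : Prop :=
  ∀ n : ℕ, f n ∈ K ∧ ∀ g ∈ K, Metric.infDist g (greedySpan f n : Set X) ≤ greedyErr f n

/-- Kolmogorov `n`-width of a set `K ⊆ X`. -/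
def kolWidth {X : Type*} [NormedAddCommGroup X] [NormedSpace ℝ X]
    (K : Set X) : ℕ → ℝ
  | 0 => ⨆ g ∈ K, ‖g‖
  | (n+1) => ⨅ L : {L : Submodule ℝ X // Module.finrank ℝ L = n + 1},
      ⨆ g ∈ K, Metric.infDist g (L.1 : Set X)

/-- Kolmogorov `n`-width of a bounded linear operator `T : E → X`. -/
def kolWidthOp {E X : Type*} [NormedAddCommGroup E] [NormedSpace ℝ E]
    [NormedAddCommGroup X] [NormedSpace ℝ X] (T : E →L[ℝ] X) : ℕ → ℝ
  | 0 => ‖T‖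
  | (n+1) => ⨅ L : {L : Submodule ℝ X // Module.finrank ℝ L = n + 1},
      ⨆ x : {x : E // ‖x‖ ≤ 1}, Metric.infDist (T x.1) (L.1 : Set X)

/-- Gelfand `n`-width of a bounded linear operator `T : E → X`. -/
def gelfandWidthOp {E X : Type*} [NormedAddCommGroup E] [NormedSpace ℝ E]
    [NormedAddCommGroup X] [NormedSpace ℝ X] (T : E →L[ℝ] X) : ℕ → ℝ
  | 0 => ‖T‖
  | (n+1) => ⨅ L : {L : Submodule ℝ E // IsClosed (L : Set E) ∧
        FiniteDimensional ℝ (E ⧸ L) ∧ Module.finrank ℝ (E ⧸ L) ≤ n + 1},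
      ⨆ x : {x : E // x ∈ L.1 ∧ ‖x‖ ≤ 1}, ‖T x.1‖

/-- The `n`-th Grothendieck number of a bounded linear operator `T : X → Y`. -/
def grothOp {X Y : Type*} [NormedAddCommGroup X] [NormedSpace ℝ X]
    [NormedAddCommGroup Y] [NormedSpace ℝ Y] (T : X →L[ℝ] Y) (n : ℕ) : ℝ :=
  ⨆ p : (Fin n → {x : X // ‖x‖ ≤ 1}) × (Fin n → {b : Y →L[ℝ] ℝ // ‖b‖ ≤ 1}),
    |Matrix.det (Matrix.of fun i j => (p.2 j).1 (T (p.1 i).1))| ^ ((1 : ℝ) / n)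

/-- The `n`-th Grothendieck number of the Banach space `X`. -/
def groth (X : Type*) [NormedAddCommGroup X] [NormedSpace ℝ X] (n : ℕ) : ℝ :=
  grothOp (ContinuousLinearMap.id ℝ X) n

/-- Banach–Mazur distance between two normed spaces. -/
def bmDist (X Y : Type*) [NormedAddCommGroup X] [NormedSpace ℝ X]
    [NormedAddCommGroup Y] [NormedSpace ℝ Y] : ℝ :=
  ⨅ T : X ≃L[ℝ] Y, ‖(T : X →L[ℝ] Y)‖ * ‖(T.symm : Y →L[ℝ] X)‖

/-- `γ_n(X)`: supremum of Banach–Mazur distances of `n`-dimensional subspaces of `X`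
to `n`-dimensional Euclidean space. -/
def gammaBM (X : Type*) [NormedAddCommGroup X] [NormedSpace ℝ X] (n : ℕ) : ℝ :=
  ⨆ V : {V : Submodule ℝ X // Module.finrank ℝ V = n},
    bmDist V.1 (EuclideanSpace ℝ (Fin n))

/-- `T` satisfies the absolutely 2-summing inequality with constant `C`. -/
def Summing2Bound {X Y : Type*} [NormedAddCommGroup X] [NormedSpace ℝ X]
    [NormedAddCommGroup Y] [NormedSpace ℝ Y] (T : X →L[ℝ] Y) (C : ℝ) : Prop :=
  ∀ (N : ℕ) (x : Fin N → X),
    (∑ i, ‖T (x i)‖ ^ 2) ^ ((1 : ℝ) / 2) ≤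
      C * ⨆ b : {b : X →L[ℝ] ℝ // ‖b‖ ≤ 1}, (∑ i, (b.1 (x i)) ^ 2) ^ ((1 : ℝ) / 2)

/-- `T` is absolutely 2-summing. -/
def IsSumming2 {X Y : Type*} [NormedAddCommGroup X] [NormedSpace ℝ X]
    [NormedAddCommGroup Y] [NormedSpace ℝ Y] (T : X →L[ℝ] Y) : Prop :=
  ∃ C : ℝ, 0 ≤ C ∧ Summing2Bound T C

/-- The 2-summing norm `‖T | B₂‖`. -/
def summing2Norm {X Y : Type*} [NormedAddCommGroup X] [NormedSpace ℝ X]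
    [NormedAddCommGroup Y] [NormedSpace ℝ Y] (T : X →L[ℝ] Y) : ℝ :=
  sInf {C : ℝ | 0 ≤ C ∧ Summing2Bound T C}

end

section LinearAlgebra

open Matrix
open scoped MatrixOrder

variable {ι : Type*} [Fintype ι]

theorem Matrix.posSemidef_of_mem_convexHull {S : Set (ι → ℝ)} {Q : Matrix ι ι ℝ}
    (hQ : Q ∈ convexHull ℝ ((fun v => vecMulVec v v) '' S)) : Q.PosSemidef := by
  have hconv : Convex ℝ {Q : Matrix ι ι ℝ | Q.PosSemidef} :=
    fun A hA B hB a b ha hb _ => (PosSemidef.smul hA ha).add (PosSemidef.smul hB hb)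
  refine convexHull_min ?_ hconv hQ
  rintro _ ⟨v, -, rfl⟩
  simpa using posSemidef_vecMulVec_self_star v

variable [DecidableEq ι]

theorem Matrix.PosSemidef.det_le_trace_div_card_pow [Nonempty ι] {P : Matrix ι ι ℝ}
    (hP : P.PosSemidef) : P.det ≤ (P.trace / Fintype.card ι) ^ Fintype.card ι := by
  have h0 : (Fintype.card ι : ℝ) ≠ 0 := by exact_mod_cast Fintype.card_ne_zero
  have hdet : P.det = ∏ i, hP.1.eigenvalues i := by simpa using hP.1.det_eq_prod_eigenvalues
  have htr : P.trace = ∑ i, hP.1.eigenvalues i := by simpa using hP.1.trace_eq_sum_eigenvalues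
  have h := Real.geom_mean_le_arith_mean_weighted Finset.univ
    (fun _ : ι => (Fintype.card ι : ℝ)⁻¹) hP.1.eigenvalues (fun _ _ => by positivity)
    (by simp [h0]) (fun i _ => hP.eigenvalues_nonneg i)
  rw [← Finset.mul_sum, Real.finsetProd_rpow _ _ (fun i _ => hP.eigenvalues_nonneg i),
    ← hdet, ← htr] at h
  calc P.det = (P.det ^ (Fintype.card ι : ℝ)⁻¹) ^ Fintype.card ι :=
        (Real.rpow_inv_natCast_pow hP.det_nonneg Fintype.card_ne_zero).symm
    _ ≤ _ := by
        rw [div_eq_inv_mul]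
        exact pow_le_pow_left₀ (Real.rpow_nonneg hP.det_nonneg _) h _

/-- A determinant form of the Cauchy–Binet formula, summed over all tuples of indices. -/
theorem Matrix.factorial_mul_det_sum_smul_vecMulVec {κ : Type*} [Fintype κ] (w : κ → ℝ)
    (v : κ → ι → ℝ) :
    ((Fintype.card ι).factorial : ℝ) * (∑ l, w l • vecMulVec (v l) (v l)).det =
      ∑ f : ι → κ, (∏ i, w (f i)) * (Matrix.of fun i => v (f i)).det ^ 2 := by
  classical
  have hexp : (∑ l, w l • vecMulVec (v l) (v l)).det =
      ∑ f : ι → κ, (∏ i, w (f i)) * (∏ i, v (f i) i) * (Matrix.of fun i => v (f i)).det := by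
    have hrow : (∑ l, w l • vecMulVec (v l) (v l)) =
        fun i => ∑ l, (w l * v l i) • v l := by
      ext i j
      simp [Matrix.sum_apply, vecMulVec_apply, mul_assoc]
    rw [hrow]
    change (detRowAlternating : (ι → ℝ) [⋀^ι]→ₗ[ℝ] ℝ).toMultilinearMap _ = _
    rw [MultilinearMap.map_sum]
    refine Finset.sum_congr rfl fun f _ => ?_
    rw [MultilinearMap.map_smul_univ, Finset.prod_mul_distrib]
    rfl
  have hperm (σ : Equiv.Perm ι) : (∑ l, w l • vecMulVec (v l) (v l)).det =
      ∑ f : ι → κ, (∏ i, w (f i)) * (σ.sign * ∏ i, v (f (σ i)) i) *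
        (Matrix.of fun i => v (f i)).det := by
    rw [hexp]
    refine Fintype.sum_equiv (Equiv.arrowCongr σ (Equiv.refl κ)) _ _ fun f => ?_
    have h1 : (Matrix.of fun i => v (f (σ.symm i))).det =
        σ.sign * (Matrix.of fun i => v (f i)).det := by
      have h := Matrix.det_permute σ.symm (Matrix.of fun i => v (f i))
      rwa [Equiv.Perm.sign_symm] at h
    have h2 : ∏ i, w (f (σ.symm i)) = ∏ i, w (f i) := Equiv.prod_comp σ.symm fun i => w (f i)
    have h3 : ((σ.sign : ℤ) : ℝ) * (σ.sign : ℤ) = 1 := by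
      exact_mod_cast Int.units_coe_mul_self σ.sign
    simp only [Equiv.arrowCongr_apply, Equiv.coe_refl, Function.comp_apply, id_eq,
      Equiv.symm_apply_apply, h1, h2]
    linear_combination (-(∏ i, w (f i)) * (∏ i, v (f i) i) * (Matrix.of fun i => v (f i)).det) * h3
  calc ((Fintype.card ι).factorial : ℝ) * (∑ l, w l • vecMulVec (v l) (v l)).det
      = ∑ _σ : Equiv.Perm ι, (∑ l, w l • vecMulVec (v l) (v l)).det := by
        simp [Fintype.card_perm]
    _ = ∑ σ : Equiv.Perm ι, ∑ f : ι → κ, (∏ i, w (f i)) * (σ.sign * ∏ i, v (f (σ i)) i) *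
        (Matrix.of fun i => v (f i)).det := Finset.sum_congr rfl fun σ _ => hperm σ
    _ = _ := by
        rw [Finset.sum_comm]
        refine Finset.sum_congr rfl fun f _ => ?_
        rw [← Finset.sum_mul, ← Finset.mul_sum, sq, mul_assoc]
        congr 2
        rw [Matrix.det_apply']
        rfl

theorem Matrix.factorial_mul_det_le_of_mem_convexHull {S : Set (ι → ℝ)} {B : ℝ}
    (hB : ∀ V : ι → ι → ℝ, (∀ i, V i ∈ S) → (Matrix.of V).det ^ 2 ≤ B) {Q : Matrix ι ι ℝ}
    (hQ : Q ∈ convexHull ℝ ((fun v => vecMulVec v v) '' S)) :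
    ((Fintype.card ι).factorial : ℝ) * Q.det ≤ B := by
  classical
  obtain ⟨κ, _, w, z, hw, hw1, hz, rfl⟩ := mem_convexHull_iff_exists_fintype.1 hQ
  choose v hvS hv using hz
  simp only [← hv]
  rw [Matrix.factorial_mul_det_sum_smul_vecMulVec]
  calc _ ≤ ∑ f : ι → κ, (∏ i, w (f i)) * B := by
        refine Finset.sum_le_sum fun f _ => ?_
        exact mul_le_mul_of_nonneg_left (hB _ fun i => hvS _)
          (Finset.prod_nonneg fun i _ => hw _)
    _ = B := by
        rw [← Finset.sum_mul, ← Fintype.prod_sum]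
        simp [hw1]

/-- Along the segment from `Q` to `v vᵀ`, expressed through the matrix determinant lemma. -/
theorem Matrix.det_smul_add_smul_vecMulVec {Q : Matrix ι ι ℝ} (hQ : IsUnit Q.det) (v : ι → ℝ)
    {t : ℝ} (ht : 1 - t ≠ 0) :
    ((1 - t) • Q + t • vecMulVec v v).det =
      (1 - t) ^ Fintype.card ι * Q.det * (1 + t / (1 - t) * (v ⬝ᵥ (Q⁻¹ *ᵥ v))) := by
  have h : (1 - t) • Q + t • vecMulVec v v =
      (1 - t) • (Q + replicateCol Unit ((t / (1 - t)) • v) * replicateRow Unit v) := by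
    ext i j
    simp [vecMulVec_apply, Matrix.mul_apply]
    field_simp
  rw [h, det_smul, det_add_replicateCol_mul_replicateRow hQ, mul_assoc]
  congr 3
  rw [det_unique, Matrix.mul_assoc, replicateCol_smul, Matrix.mul_smul, Matrix.mul_smul,
    ← replicateCol_mulVec]
  simp [Matrix.mul_apply, dotProduct]

/-- An approximately `D`-optimal design on a bounded set `S` of vectors. -/
theorem Matrix.exists_posDef_dotProduct_inv_mulVec_le [Nonempty ι] {S : Set (ι → ℝ)} {B : ℝ}
    (hB : ∀ V : ι → ι → ℝ, (∀ i, V i ∈ S) → (Matrix.of V).det ^ 2 ≤ B)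
    {V : ι → ι → ℝ} (hVS : ∀ i, V i ∈ S) (hV : (Matrix.of V).det ≠ 0) :
    ∃ Q : Matrix ι ι ℝ, Q.PosDef ∧ (Fintype.card ι).factorial * Q.det ≤ B ∧
      ∀ v ∈ S, v ⬝ᵥ (Q⁻¹ *ᵥ v) ≤ 2 * Fintype.card ι := by
  classical
  set K : Set (Matrix ι ι ℝ) := convexHull ℝ ((fun v => vecMulVec v v) '' S)
  set n : ℝ := (Fintype.card ι : ℝ) with hn
  have hn1 : 1 ≤ n := Nat.one_le_cast.2 Fintype.card_pos
  have hfac : (0 : ℝ) < (Fintype.card ι).factorial := by positivity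
  have hbdd : BddAbove (det '' K) := by
    refine ⟨B / (Fintype.card ι).factorial, ?_⟩
    rintro _ ⟨Q, hQ, rfl⟩
    rw [le_div_iff₀ hfac, mul_comm]
    exact Matrix.factorial_mul_det_le_of_mem_convexHull hB hQ
  obtain ⟨Q₀, hQ₀K, hQ₀⟩ : ∃ Q ∈ K, 0 < Q.det := by
    refine ⟨∑ i, n⁻¹ • vecMulVec (V i) (V i), ?_, ?_⟩
    · refine (convex_convexHull ℝ _).sum_mem (fun _ _ => by positivity) ?_ fun i _ =>
        subset_convexHull ℝ _ ⟨V i, hVS i, rfl⟩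
      simp [hn]
    · have h : (∑ i, n⁻¹ • vecMulVec (V i) (V i)) = n⁻¹ • ((Matrix.of V)ᵀ * Matrix.of V) := by
        ext i j
        simp [Matrix.sum_apply, vecMulVec_apply, Matrix.mul_apply, Finset.mul_sum]
      rw [h, det_smul, det_mul, det_transpose, ← sq]
      positivity
  set D : ℝ := sSup (det '' K)
  have hDpos : 0 < D := hQ₀.trans_le (le_csSup hbdd ⟨Q₀, hQ₀K, rfl⟩)
  have hδ : D / (1 + 1 / (4 * n)) < D := div_lt_self hDpos (by simp; positivity)
  obtain ⟨_, ⟨Q, hQK, rfl⟩, hQ⟩ :=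
    exists_lt_of_lt_csSup (Set.Nonempty.image _ ⟨Q₀, hQ₀K⟩) hδ
  have hQpos : 0 < Q.det := lt_trans (by positivity) hQ
  refine ⟨Q, (Matrix.posSemidef_of_mem_convexHull hQK).posDef_iff_det_ne_zero.2 hQpos.ne',
    Matrix.factorial_mul_det_le_of_mem_convexHull hB hQK, fun v hv => ?_⟩
  set s : ℝ := v ⬝ᵥ (Q⁻¹ *ᵥ v)
  by_contra! hs
  set t : ℝ := 1 / (2 * n) with ht
  have ht0 : 0 < t := by positivity
  have htn : t * n = 1 / 2 := by rw [ht]; field_simp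
  have ht1 : t ≤ 1 / 2 := by nlinarith
  have hmem : (1 - t) • Q + t • vecMulVec v v ∈ K :=
    convex_convexHull ℝ _ hQK (subset_convexHull ℝ _ ⟨v, hv, rfl⟩) (by linarith) ht0.le (by ring)
  have hle : (1 - t) ^ Fintype.card ι * Q.det * (1 + t / (1 - t) * s) ≤ D := by
    rw [← Matrix.det_smul_add_smul_vecMulVec hQpos.ne'.isUnit v (by linarith)]
    exact le_csSup hbdd ⟨_, hmem, rfl⟩
  have hlt : D < (1 + 1 / (4 * n)) * Q.det := by
    rwa [div_lt_iff₀ (by positivity), mul_comm] at hQ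
  have hlt' : (1 - t) ^ Fintype.card ι * (1 + t / (1 - t) * s) < 1 + 1 / (4 * n) := by
    refine lt_of_mul_lt_mul_right ?_ hQpos.le
    linarith
  obtain ⟨m, hm⟩ := Nat.exists_eq_succ_of_ne_zero (Fintype.card_ne_zero (α := ι))
  have hnm : n = m + 1 := by rw [hn, hm]; push_cast; rfl
  have hbern : 1 - m * t ≤ (1 - t) ^ m := by
    have := one_add_mul_le_pow (a := -t) (by linarith) m
    simpa [sub_eq_add_neg] using this
  have hfactor : (1 - t) ^ Fintype.card ι * (1 + t / (1 - t) * s) =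
      (1 - t) ^ m * (1 + t * (s - 1)) := by
    have : 1 - t ≠ 0 := by linarith
    rw [hm, pow_succ]
    field_simp
    ring
  rw [hfactor] at hlt'
  have h4 : 1 / (4 * n) = t / 2 := by rw [ht]; field_simp; norm_num
  rw [h4] at hlt'
  have hmt : m * t = 1 / 2 - t := by rw [← htn, hnm]; ring
  rw [hmt] at hbern
  have h2 : 2 - t ≤ 1 + t * (s - 1) := by nlinarith
  nlinarith [mul_le_mul hbern h2 (by linarith) (by linarith : (0:ℝ) ≤ (1 - t) ^ m)]

/-- If `W M` has trace at most `K` for every `W` whose rows form, on `S`, a family of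
square sum at most `2 card ι`, then `det M` is controlled by the determinants on `S`. -/
theorem Matrix.factorial_mul_det_sq_le [Nonempty ι] {S : Set (ι → ℝ)} {B K : ℝ}
    (hB : ∀ V : ι → ι → ℝ, (∀ i, V i ∈ S) → (Matrix.of V).det ^ 2 ≤ B)
    {V : ι → ι → ℝ} (hVS : ∀ i, V i ∈ S) (hV : (Matrix.of V).det ≠ 0)
    {M : Matrix ι ι ℝ}
    (hM : ∀ W : Matrix ι ι ℝ, (∀ v ∈ S, (W *ᵥ v) ⬝ᵥ (W *ᵥ v) ≤ 2 * Fintype.card ι) →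
      (W * M).trace ≤ K) :
    (Fintype.card ι).factorial * M.det ^ 2 ≤
      (K / Fintype.card ι) ^ (2 * Fintype.card ι) * B := by
  have hB0 : 0 ≤ B := (sq_nonneg _).trans (hB V hVS)
  have hK (k : ℝ) : 0 ≤ k ^ (2 * Fintype.card ι) := (even_two_mul _).pow_nonneg k
  obtain hM0 | hM0 := eq_or_ne M.det 0
  · rw [hM0]
    simpa using mul_nonneg (hK _) hB0
  obtain ⟨Q, hQ, hQB, hQS⟩ := Matrix.exists_posDef_dotProduct_inv_mulVec_le hB hVS hV
  have hMu : IsUnit M.det := hM0.isUnit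
  have hR : (Mᵀ * Q⁻¹ * M).PosSemidef := by
    simpa using hQ.inv.posSemidef.conjTranspose_mul_mul_same M
  set P := CFC.sqrt (Mᵀ * Q⁻¹ * M)
  have hP : P.PosSemidef := Matrix.nonneg_iff_posSemidef.1 (CFC.sqrt_nonneg _)
  have hPt : Pᵀ = P := by simpa using hP.1.eq
  have hPP : P * P = Mᵀ * Q⁻¹ * M := CFC.sqrt_mul_sqrt_self _ hR.nonneg
  have hW : (P * M⁻¹)ᵀ * (P * M⁻¹) = Q⁻¹ := by
    rw [transpose_mul, hPt, Matrix.mul_assoc, ← Matrix.mul_assoc P, hPP, transpose_nonsing_inv,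
      Matrix.mul_assoc, Matrix.mul_assoc, Matrix.mul_nonsing_inv _ hMu,
      Matrix.mul_one, ← Matrix.mul_assoc, Matrix.nonsing_inv_mul _ (by simpa using hMu),
      Matrix.one_mul]
  have htr : P.trace ≤ K := by
    have h := hM (P * M⁻¹) fun v hv => ?_
    · rwa [Matrix.mul_assoc, Matrix.nonsing_inv_mul _ hMu, Matrix.mul_one] at h
    · rw [dotProduct_mulVec, ← mulVec_transpose, mulVec_mulVec, hW, dotProduct_comm]
      exact hQS v hv
  have hdet : M.det ^ 2 = P.det ^ 2 * Q.det := by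
    have h := congrArg det hPP
    have hQ0 := hQ.det_pos.ne'
    simp only [det_mul, det_transpose, det_nonsing_inv, Ring.inverse_eq_inv'] at h
    field_simp at h
    linarith
  have hPK : P.det ≤ (K / Fintype.card ι) ^ Fintype.card ι := by
    refine hP.det_le_trace_div_card_pow.trans ?_
    have := hP.trace_nonneg
    gcongr
  calc _ = P.det ^ 2 * ((Fintype.card ι).factorial * Q.det) := by rw [hdet]; ring
    _ ≤ ((K / Fintype.card ι) ^ Fintype.card ι) ^ 2 * B := by
        have := hP.det_nonneg
        have := hQ.det_pos
        gcongr
    _ = _ := by rw [← pow_mul, mul_comm 2]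

end LinearAlgebra

section GrothendieckNumbers

variable {X Y : Type*} [NormedAddCommGroup X] [NormedSpace ℝ X]
  [NormedAddCommGroup Y] [NormedSpace ℝ Y]

theorem abs_apply_le_of_norm_le_one {x : X} (hx : ‖x‖ ≤ 1) {b : X →L[ℝ] ℝ} (hb : ‖b‖ ≤ 1) :
    |b x| ≤ 1 :=
  (b.le_opNorm x).trans (mul_le_one₀ hb (norm_nonneg _) hx)

theorem bddAbove_groth (n : ℕ) : BddAbove (Set.range
    fun p : (Fin n → {x : X // ‖x‖ ≤ 1}) × (Fin n → {b : X →L[ℝ] ℝ // ‖b‖ ≤ 1}) =>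
      |Matrix.det (Matrix.of fun i j => (p.2 j).1 (ContinuousLinearMap.id ℝ X (p.1 i).1))| ^
        ((1 : ℝ) / n)) := by
  refine ⟨(n.factorial : ℝ) ^ ((1 : ℝ) / n), ?_⟩
  rintro _ ⟨p, rfl⟩
  refine Real.rpow_le_rpow (abs_nonneg _) ?_ (by positivity)
  simpa using Matrix.det_le (abv := AbsoluteValue.abs)
    (A := Matrix.of fun i j => (p.2 j).1 (p.1 i).1) (x := (1 : ℝ))
    fun i j => abs_apply_le_of_norm_le_one (p.1 i).2 (p.2 j).2

theorem groth_nonneg (n : ℕ) : 0 ≤ groth X n :=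
  Real.iSup_nonneg fun _ => by positivity

theorem abs_det_le_groth_pow {n : ℕ} (hn : n ≠ 0) {x : Fin n → X} (hx : ∀ i, ‖x i‖ ≤ 1)
    {b : Fin n → X →L[ℝ] ℝ} (hb : ∀ j, ‖b j‖ ≤ 1) :
    |(Matrix.of fun i j => b j (x i)).det| ≤ groth X n ^ n := by
  have h : |(Matrix.of fun i j => b j (x i)).det| ^ ((1 : ℝ) / n) ≤ groth X n :=
    le_ciSup (bddAbove_groth (X := X) n) (fun i => ⟨x i, hx i⟩, fun j => ⟨b j, hb j⟩)
  calc _ = (|(Matrix.of fun i j => b j (x i)).det| ^ ((1 : ℝ) / n)) ^ n := by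
        rw [one_div, Real.rpow_inv_natCast_pow (abs_nonneg _) hn]
    _ ≤ _ := by gcongr

theorem summing2Norm_nonneg (T : X →L[ℝ] Y) : 0 ≤ summing2Norm T :=
  Real.sInf_nonneg fun _ h => h.1

/-- The infimum defining the 2-summing norm is attained. -/
theorem IsSumming2.summing2Bound_summing2Norm {T : X →L[ℝ] Y} (hT : IsSumming2 T) :
    Summing2Bound T (summing2Norm T) := by
  intro N x
  obtain ⟨C₀, hC₀, hTC₀⟩ := hT
  set s : ℝ := ⨆ b : {b : X →L[ℝ] ℝ // ‖b‖ ≤ 1}, (∑ i, (b.1 (x i)) ^ 2) ^ ((1 : ℝ) / 2)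
  have hs : 0 ≤ s := Real.iSup_nonneg fun _ => by positivity
  obtain hs | hs := hs.eq_or_lt
  · have h : _ ≤ C₀ * s := hTC₀ N x
    rwa [← hs, mul_zero] at h ⊢
  · rw [← div_le_iff₀ hs]
    exact le_csInf ⟨C₀, hC₀, hTC₀⟩ fun C hC => (div_le_iff₀ hs).2 (hC.2 N x)

theorem IsSumming2.sum_norm_le {T : X →L[ℝ] Y} (hT : IsSumming2 T) {n : ℕ} (w : Fin n → X)
    {R : ℝ} (hw : ∀ b : X →L[ℝ] ℝ, ‖b‖ ≤ 1 → ∑ k, b (w k) ^ 2 ≤ R) :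
    ∑ k, ‖T (w k)‖ ≤ √n * (summing2Norm T * √R) := by
  have h := hT.summing2Bound_summing2Norm n w
  simp only [← Real.sqrt_eq_rpow] at h
  have hsup : (⨆ b : {b : X →L[ℝ] ℝ // ‖b‖ ≤ 1}, √(∑ i, (b.1 (w i)) ^ 2)) ≤ √R :=
    Real.iSup_le (fun b => Real.sqrt_le_sqrt (hw b.1 b.2)) (Real.sqrt_nonneg _)
  calc ∑ k, ‖T (w k)‖ ≤ √(n * ∑ k, ‖T (w k)‖ ^ 2) := by
        refine Real.le_sqrt_of_sq_le ?_
        simpa using sq_sum_le_card_mul_sum_sq (s := Finset.univ) (f := fun k => ‖T (w k)‖)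
    _ = √n * √(∑ k, ‖T (w k)‖ ^ 2) := Real.sqrt_mul n.cast_nonneg _
    _ ≤ _ := by
        gcongr
        exact h.trans (mul_le_mul_of_nonneg_left hsup (summing2Norm_nonneg T))

theorem IsSumming2.factorial_mul_det_sq_le {T : X →L[ℝ] Y} (hT : IsSumming2 T) {n : ℕ}
    (hn : n ≠ 0) {x : Fin n → X} (hx : ∀ i, ‖x i‖ ≤ 1) {b : Fin n → Y →L[ℝ] ℝ}
    (hb : ∀ j, ‖b j‖ ≤ 1) :
    (n.factorial : ℝ) * (Matrix.of fun i j => b j (T (x i))).det ^ 2 ≤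
      (2 * summing2Norm T ^ 2 * groth X n ^ 2) ^ n := by
  have : NeZero n := ⟨hn⟩
  have hn0 : (n : ℝ) ≠ 0 := by exact_mod_cast hn
  have hG := groth_nonneg (X := X) n
  have hC := summing2Norm_nonneg T
  set M : Matrix (Fin n) (Fin n) ℝ := Matrix.of fun i j => b j (T (x i)) with hMdef
  obtain hM0 | hM0 := eq_or_ne M.det 0
  · rw [hM0]
    simp only [ne_eq, OfNat.ofNat_ne_zero, not_false_eq_true, zero_pow, mul_zero]
    positivity
  set S : Set (Fin n → ℝ) := {v | ∃ a : X →L[ℝ] ℝ, ‖a‖ ≤ 1 ∧ v = fun i => a (x i)}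
  have hB (V : Fin n → Fin n → ℝ) (hV : ∀ i, V i ∈ S) :
      (Matrix.of V).det ^ 2 ≤ (groth X n ^ n) ^ 2 := by
    choose a ha hVa using hV
    have hVt : Matrix.of V = (Matrix.of fun i j => a j (x i)).transpose := by
      ext i j
      simp [hVa]
    rw [hVt, Matrix.det_transpose, ← sq_abs]
    have := abs_det_le_groth_pow hn hx ha
    gcongr
  set c : ℝ := (‖T‖ + 1)⁻¹ with hc
  have hc0 : 0 < c := by positivity
  have hVS (j : Fin n) : c • M.transpose j ∈ S := by
    refine ⟨c • (b j).comp T, ?_, ?_⟩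
    · rw [norm_smul, Real.norm_of_nonneg hc0.le, hc, inv_mul_le_one₀ (by positivity)]
      have := (b j).opNorm_comp_le T
      nlinarith [hb j, norm_nonneg T]
    · ext i
      simp [hMdef]
  have hV : (Matrix.of fun j => c • M.transpose j).det ≠ 0 := by
    have h : (Matrix.of fun j => c • M.transpose j) = c • M.transpose := rfl
    rw [h, Matrix.det_smul, Matrix.det_transpose]
    positivity
  have key := Matrix.factorial_mul_det_sq_le hB hVS hV (M := M)
    (K := √n * (summing2Norm T * √(2 * n))) fun W hW => ?_
  · rw [Fintype.card_fin] at key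
    refine key.trans_eq ?_
    have hK : √n * (summing2Norm T * √(2 * n)) / n = summing2Norm T * √2 := by
      rw [Real.sqrt_mul zero_le_two]
      have := Real.mul_self_sqrt n.cast_nonneg
      field_simp
      linear_combination summing2Norm T * this
    rw [hK, pow_mul, mul_pow _ (√2), Real.sq_sqrt zero_le_two, ← pow_mul, mul_comm n 2,
      pow_mul, ← mul_pow]
    ring
  · set w : Fin n → X := fun k => ∑ i, W k i • x i with hw
    have htr : (W * M).trace = ∑ k, b k (T (w k)) := by
      simp [Matrix.trace, Matrix.mul_apply, hw, hMdef, map_sum]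
    rw [htr]
    refine (Finset.sum_le_sum fun k _ => ?_).trans (hT.sum_norm_le w fun a ha => ?_)
    · exact (le_abs_self _).trans (((b k).le_opNorm _).trans
        (mul_le_of_le_one_left (norm_nonneg _) (hb k)))
    · have h := hW _ ⟨a, ha, rfl⟩
      rw [Fintype.card_fin] at h
      convert h using 1
      simp [dotProduct, Matrix.mulVec, hw, map_sum, sq]

end GrothendieckNumbers

theorem groth_le_of_summing2
    {X Y : Type*} [NormedAddCommGroup X] [NormedSpace ℝ X] [CompleteSpace X]
    [NormedAddCommGroup Y] [NormedSpace ℝ Y] [CompleteSpace Y]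
    (T : X →L[ℝ] Y) (hT : IsSumming2 T) :
    ∀ n : ℕ, 1 ≤ n →
      grothOp T n ≤ Real.exp 1 * (n : ℝ) ^ (-(1 : ℝ) / 2) * summing2Norm T * groth X n := by
  intro n hn
  have hn0 : n ≠ 0 := by omega
  have hnpos : (0 : ℝ) < n := by exact_mod_cast hn
  have hG := groth_nonneg (X := X) n
  have hC := summing2Norm_nonneg T
  set r : ℝ := Real.exp 1 * (n : ℝ) ^ (-(1 : ℝ) / 2) * summing2Norm T * groth X n with hr
  have hr0 : 0 ≤ r := by positivity
  have hr2 : r ^ 2 = Real.exp 1 ^ 2 * summing2Norm T ^ 2 * groth X n ^ 2 / n := by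
    have h : ((n : ℝ) ^ (-(1 : ℝ) / 2)) ^ 2 = (n : ℝ)⁻¹ := by
      rw [← Real.rpow_natCast, ← Real.rpow_mul hnpos.le, ← Real.rpow_neg_one]
      norm_num
    rw [hr, mul_pow, mul_pow, mul_pow, h]
    ring
  refine Real.iSup_le (fun p => ?_) hr0
  have hdet := hT.factorial_mul_det_sq_le hn0 (fun i => (p.1 i).2) fun j => (p.2 j).2
  set d : ℝ := (Matrix.of fun i j => (p.2 j).1 (T (p.1 i).1)).det
  have hfac : (n : ℝ) ^ n ≤ Real.exp 1 ^ n * n.factorial := by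
    have h := Real.pow_div_factorial_le_exp (n : ℝ) hnpos.le n
    rwa [div_le_iff₀ (by positivity), ← Real.exp_one_pow] at h
  have he : 2 ≤ Real.exp 1 := by linarith [Real.add_one_le_exp 1]
  have hd : d ^ 2 ≤ (r ^ n) ^ 2 := by
    rw [← pow_mul, mul_comm n 2, pow_mul, hr2, div_pow, le_div_iff₀ (by positivity)]
    calc d ^ 2 * n ^ n ≤ d ^ 2 * (Real.exp 1 ^ n * n.factorial) := by gcongr
      _ = Real.exp 1 ^ n * (n.factorial * d ^ 2) := by ring
      _ ≤ Real.exp 1 ^ n * (2 * summing2Norm T ^ 2 * groth X n ^ 2) ^ n := by gcongr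
      _ ≤ Real.exp 1 ^ n * (Real.exp 1 * summing2Norm T ^ 2 * groth X n ^ 2) ^ n := by gcongr
      _ = _ := by rw [← mul_pow]; ring
  have habs : |d| ≤ r ^ n := abs_le_of_sq_le_sq hd (by positivity)
  calc |d| ^ ((1 : ℝ) / n) ≤ (r ^ n) ^ ((1 : ℝ) / n) := by gcongr
    _ = r := by rw [one_div, Real.pow_rpow_inv_natCast hr0 hn0]
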